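/- Fix 2 < p < ∞. There is no continuous negative definite function g : ℓ_p → ℝ such that: (i) g(0) = 0; (ii) g is symmetric, i.e., g(T_{θ,σ} x) = g(x) for every sequence of signs θ : ℕ → {−1,+1}, every permutation σ of ℕ, and every x ∈ ℓ_p; and (iii) g(x) ≥ φ₁(‖x‖) for all x, for some nondecreasing φ₁ : [0,∞) → [0,∞) with φ₁(t) → ∞ as t → ∞. -/

import Mathlib

open scoped NNReal ENNReal
open Filter

/-- For a sequence of signs `θ : ℕ → {−1,+1}` and a permutation `σ` of `ℕ`, the linear
isometry `T_{θ,σ}` of `ℓ_p` given coordinatewise by `(T_{θ,σ} x) n = θ n * x (σ⁻¹ n)`. -/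
noncomputable def signPermMap (p : ℝ≥0∞) [Fact (1 ≤ p)] (hp : p ≠ ∞)
    (θ : ℕ → ℝ) (hθ : ∀ n, θ n = 1 ∨ θ n = -1) (σ : Equiv.Perm ℕ)
    (x : lp (fun _ : ℕ => ℝ) p) : lp (fun _ : ℕ => ℝ) p :=
  ⟨fun n => θ n * x (σ.symm n), by
    have hp0 : 0 < p.toReal := by
      have h1 : (1 : ℝ≥0∞) ≤ p := Fact.out
      exact ENNReal.toReal_pos (by positivity) hp
    apply memℓp_gen
    have hx : Summable fun i => ‖(x : ∀ _ : ℕ, ℝ) i‖ ^ p.toReal :=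
      (memℓp_gen_iff hp0).1 (lp.memℓp x)
    have := (Equiv.summable_iff σ.symm (f := fun i => ‖(x : ∀ _ : ℕ, ℝ) i‖ ^ p.toReal)).2 hx
    convert this using 2 with n
    have : |θ n| = 1 := by rcases hθ n with h | h <;> simp [h]
    simp [Real.norm_eq_abs, abs_mul, this, Function.comp]⟩

/-- Positive definiteness of a real function on an abelian group. -/
def IsPosDefFun {X : Type*} [AddCommGroup X] (h : X → ℝ) : Prop :=
  ∀ (ι : Type) [Fintype ι] (x : ι → X) (c : ι → ℝ), 0 ≤ ∑ i, ∑ j, c i * c j * h (x i - x j)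

/-- Negative definiteness of a real function on an abelian group. -/
def IsNegDefFun {X : Type*} [AddCommGroup X] (h : X → ℝ) : Prop :=
  ∀ (ι : Type) [Fintype ι] (x : ι → X) (c : ι → ℝ), ∑ i, c i = 0 →
    ∑ i, ∑ j, c i * c j * h (x i - x j) ≤ 0

/-- The average of `h` over the lazy random walk step `{0, 0, v, -v}`. -/
noncomputable def lazyAverage {X : Type*} [AddCommGroup X] (v : X) (h : X → ℝ) (x : X) : ℝ :=
  (2 * h x + h (x + v) + h (x - v)) / 4

/-- The function obtained from `g` by averaging over lazy steps along `v 0, …, v (n - 1)`. -/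
noncomputable def iteratedAverage {X : Type*} [AddCommGroup X] (v : ℕ → X) (g : X → ℝ) :
    ℕ → X → ℝ
  | 0 => g
  | n + 1 => lazyAverage (v n) (iteratedAverage v g n)

section

variable {X : Type*} [AddCommGroup X]

lemma isNegDefFun_of_fin {g : X → ℝ}
    (hg : ∀ (n : ℕ) (x : Fin n → X) (c : Fin n → ℝ), (∑ i, c i) = 0 →
      ∑ i, ∑ j, c i * c j * g (x i - x j) ≤ 0) : IsNegDefFun g := by
  intro ι _ x c hc
  let e := (Fintype.equivFin ι).symm
  have h := hg _ (x ∘ e) (c ∘ e) (by rw [← hc]; exact Equiv.sum_comp e c)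
  rw [← Equiv.sum_comp e]
  refine le_of_eq_of_le (Finset.sum_congr rfl fun i _ => ?_) h
  exact (Equiv.sum_comp e fun j => c (e i) * c j * g (x (e i) - x j)).symm

lemma sum_sum_translates (h : X → ℝ) (v : X) (s : ℝ) {ι : Type} [Fintype ι] (x : ι → X)
    (c : ι → ℝ) :
    ∑ i : ι ⊕ ι, ∑ j : ι ⊕ ι, (Sum.elim c (fun k => s * c k) i) *
        (Sum.elim c (fun k => s * c k) j) *
        h (Sum.elim x (fun k => x k + v) i - Sum.elim x (fun k => x k + v) j) =
      ∑ i, ∑ j, c i * c j * ((1 + s ^ 2) * h (x i - x j) +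
        s * (h (x i - x j + v) + h (x i - x j - v))) := by
  simp only [Fintype.sum_sum_type, Sum.elim_inl, Sum.elim_inr, ← Finset.sum_add_distrib]
  refine Finset.sum_congr rfl fun i _ => Finset.sum_congr rfl fun j _ => ?_
  rw [show x i + v - (x j + v) = x i - x j by abel, show x i + v - x j = x i - x j + v by abel,
    show x i - (x j + v) = x i - x j - v by abel]
  ring

lemma IsNegDefFun.lazyAverage {h : X → ℝ} (hh : IsNegDefFun h) (v : X) :
    IsNegDefFun (lazyAverage v h) := by
  intro ι _ x c hc
  have key := hh (ι ⊕ ι) (Sum.elim x fun k => x k + v) (Sum.elim c fun k => 1 * c k)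
    (by simp [hc])
  rw [sum_sum_translates] at key
  have : ∑ i, ∑ j, c i * c j * _root_.lazyAverage v h (x i - x j) =
      (1 / 4) * ∑ i, ∑ j, c i * c j * ((1 + 1 ^ 2) * h (x i - x j) +
        1 * (h (x i - x j + v) + h (x i - x j - v))) := by
    simp only [Finset.mul_sum]
    refine Finset.sum_congr rfl fun i _ => Finset.sum_congr rfl fun j _ => ?_
    unfold _root_.lazyAverage
    ring
  rw [this]
  exact mul_nonpos_of_nonneg_of_nonpos (by norm_num) key

lemma IsNegDefFun.isPosDefFun_lazyAverage_sub {h : X → ℝ} (hh : IsNegDefFun h) (v : X) :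
    IsPosDefFun fun x => _root_.lazyAverage v h x - h x := by
  intro ι _ x c
  have key := hh (ι ⊕ ι) (Sum.elim x fun k => x k + v) (Sum.elim c fun k => (-1) * c k)
    (by simp)
  rw [sum_sum_translates] at key
  have : ∑ i, ∑ j, c i * c j * (_root_.lazyAverage v h (x i - x j) - h (x i - x j)) =
      (-1 / 4) * ∑ i, ∑ j, c i * c j * ((1 + (-1) ^ 2) * h (x i - x j) +
        (-1) * (h (x i - x j + v) + h (x i - x j - v))) := by
    simp only [Finset.mul_sum]
    refine Finset.sum_congr rfl fun i _ => Finset.sum_congr rfl fun j _ => ?_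
    unfold _root_.lazyAverage
    ring
  exact (mul_nonneg_of_nonpos_of_nonpos (by norm_num) key).trans_eq this.symm

lemma IsPosDefFun.add {h k : X → ℝ} (hh : IsPosDefFun h) (hk : IsPosDefFun k) :
    IsPosDefFun fun x => h x + k x := by
  intro ι _ x c
  have := add_nonneg (hh ι x c) (hk ι x c)
  simpa only [← Finset.sum_add_distrib, ← mul_add] using this

lemma IsPosDefFun.zero_nonneg {q : X → ℝ} (hq : IsPosDefFun q) : 0 ≤ q 0 := by
  simpa using hq Unit (fun _ => 0) fun _ => 1

lemma IsPosDefFun.add_neg_le {q : X → ℝ} (hq : IsPosDefFun q) (x : X) :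
    q x + q (-x) ≤ 2 * q 0 := by
  have := hq (Fin 2) ![x, 0] ![1, -1]
  simp [Fin.sum_univ_two] at this
  linarith

lemma IsPosDefFun.neg_le_add_neg {q : X → ℝ} (hq : IsPosDefFun q) (x : X) :
    -(2 * q 0) ≤ q x + q (-x) := by
  have := hq (Fin 2) ![x, 0] ![1, 1]
  simp [Fin.sum_univ_two] at this
  linarith

/-- Quadratic growth of negative definite functions along multiples. -/
lemma IsNegDefFun.nsmul_le {h : X → ℝ} (hh : IsNegDefFun h) (v : X) (m : ℕ) :
    h (m • v) + h (-(m • v)) - 2 * h 0 ≤ m ^ 2 * (4 * (_root_.lazyAverage v h 0 - h 0)) := by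
  set d := 4 * (_root_.lazyAverage v h 0 - h 0) with hd
  have step : ∀ k : ℕ, (h ((k + 1) • v) + h (-((k + 1) • v))) - (h (k • v) + h (-(k • v))) ≤
      (2 * k + 1) * d := by
    intro k
    induction k with
    | zero =>
      simp only [hd, _root_.lazyAverage]
      simp
      linarith
    | succ k ih =>
      have h1 := (hh.isPosDefFun_lazyAverage_sub v).add_neg_le ((k + 1) • v)
      simp only [_root_.lazyAverage] at h1
      rw [show (k + 1) • v + v = (k + 1 + 1) • v from (succ_nsmul v (k + 1)).symm,
        show (k + 1) • v - v = k • v by rw [succ_nsmul]; abel,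
        show -((k + 1) • v) + v = -(k • v) by rw [succ_nsmul]; abel,
        show -((k + 1) • v) - v = -((k + 1 + 1) • v) by rw [succ_nsmul v (k + 1)]; abel] at h1
      simp only [hd, _root_.lazyAverage] at ih ⊢
      push_cast
      linarith
  induction m with
  | zero => simp; linarith
  | succ m ih =>
    have := step m
    push_cast
    linarith

lemma IsNegDefFun.iteratedAverage {g : X → ℝ} (hg : IsNegDefFun g) (v : ℕ → X) (n : ℕ) :
    IsNegDefFun (iteratedAverage v g n) := by
  induction n with
  | zero => exact hg
  | succ n ih => exact ih.lazyAverage (v n)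

lemma IsNegDefFun.isPosDefFun_iteratedAverage_sub {g : X → ℝ} (hg : IsNegDefFun g) (v : ℕ → X)
    (n : ℕ) : IsPosDefFun fun x => _root_.iteratedAverage v g n x - g x := by
  induction n with
  | zero => intro ι _ x c; simp [_root_.iteratedAverage]
  | succ n ih =>
    have := ih.add ((hg.iteratedAverage v n).isPosDefFun_lazyAverage_sub (v n))
    convert this using 2 with x
    simp only [_root_.iteratedAverage]
    ring

lemma IsNegDefFun.iteratedAverage_zero_le_succ {g : X → ℝ} (hg : IsNegDefFun g) (v : ℕ → X)
    (n : ℕ) : _root_.iteratedAverage v g n 0 ≤ _root_.iteratedAverage v g (n + 1) 0 :=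
  sub_nonneg.1 ((hg.iteratedAverage v n).isPosDefFun_lazyAverage_sub (v n)).zero_nonneg

/-- A metric cotype 2 inequality for negative definite functions. -/
lemma IsNegDefFun.sum_nsmul_le {g : X → ℝ} (hg : IsNegDefFun g) (v : ℕ → X) (m n : ℕ) :
    ∑ k ∈ Finset.range n, (g (m • v k) + g (-(m • v k)) - 2 * g 0) ≤
      4 * (m ^ 2 + n) * (_root_.iteratedAverage v g n 0 - g 0) := by
  induction n with
  | zero => simp [_root_.iteratedAverage]
  | succ n ih =>
    rw [Finset.sum_range_succ]
    have h1 := (hg.iteratedAverage v n).nsmul_le (v n) m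
    have h2 := (hg.isPosDefFun_iteratedAverage_sub v n).neg_le_add_neg (m • v n)
    have h3 := hg.iteratedAverage_zero_le_succ v n
    have h4 := mul_le_mul_of_nonneg_left h3 (Nat.cast_nonneg (α := ℝ) n)
    change _ ≤ (m : ℝ) ^ 2 * (4 * (_root_.iteratedAverage v g (n + 1) 0 - _)) at h1
    push_cast
    linarith

lemma iteratedAverage_le {g : X → ℝ} {v : ℕ → X} {b : ℝ} (n : ℕ) (x : X)
    (hb : ∀ ε : ℕ → ℤ, (∀ i, |ε i| ≤ 1) → g (x + ∑ i ∈ Finset.range n, ε i • v i) ≤ b) :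
    iteratedAverage v g n x ≤ b := by
  induction n generalizing x with
  | zero => simpa [iteratedAverage] using hb 0 (by simp)
  | succ n ih =>
    have key : ∀ a : ℤ, |a| ≤ 1 → iteratedAverage v g n (x + a • v n) ≤ b := by
      intro a ha
      refine ih _ fun ε hε => ?_
      have := hb (Function.update ε n a) fun i => by
        by_cases hi : i = n
        · subst hi; simpa using ha
        · simpa [hi] using hε i
      rw [Finset.sum_range_succ, Function.update_self, Finset.sum_congr rfl
        (g := fun i => ε i • v i)] at this
      · rwa [add_assoc, add_comm (a • v n)]
      · intro i hi
        rw [Function.update_of_ne (Finset.mem_range.1 hi).ne]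
    have h0 := key 0 (by simp)
    have h1 := key 1 (by simp)
    have h2 := key (-1) (by simp)
    rw [zero_smul, add_zero] at h0
    rw [one_smul] at h1
    rw [neg_smul, one_smul, ← sub_eq_add_neg] at h2
    simp only [iteratedAverage, lazyAverage]
    linarith

end

lemma norm_sum_zsmul_single_rpow_le {p : ℝ} (hp : 0 < p) [Fact (1 ≤ ENNReal.ofReal p)]
    (δ : ℝ) (hδ : 0 ≤ δ) (n : ℕ) (ε : ℕ → ℤ) (hε : ∀ i, |ε i| ≤ 1) :
    ‖∑ i ∈ Finset.range n, ε i • (lp.single (E := fun _ : ℕ => ℝ) (ENNReal.ofReal p) i δ)‖ ^ p ≤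
      n * δ ^ p := by
  have hp1 : (ENNReal.ofReal p).toReal = p := ENNReal.toReal_ofReal hp.le
  have h := lp.norm_sum_single (E := fun _ : ℕ => ℝ) (p := ENNReal.ofReal p)
    (by rw [hp1]; exact hp) (fun i => (ε i : ℝ) * δ) (Finset.range n)
  rw [hp1] at h
  have h2 : ∀ i, ε i • (lp.single (E := fun _ : ℕ => ℝ) (ENNReal.ofReal p) i δ) =
      lp.single (E := fun _ : ℕ => ℝ) (ENNReal.ofReal p) i ((ε i : ℝ) * δ) := by
    intro i
    rw [← zsmul_eq_mul]
    exact (map_zsmul (lp.singleAddMonoidHom (E := fun _ : ℕ => ℝ) (ENNReal.ofReal p) i) _ _).symm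
  simp only [h2]
  rw [h]
  calc _ ≤ ∑ i ∈ Finset.range n, δ ^ p := by
        refine Finset.sum_le_sum fun i _ => Real.rpow_le_rpow (norm_nonneg _) ?_ hp.le
        rw [norm_mul, Real.norm_eq_abs, Real.norm_eq_abs, abs_of_nonneg hδ]
        have : |(ε i : ℝ)| ≤ 1 := by exact_mod_cast hε i
        exact mul_le_of_le_one_left hδ this
    _ = n * δ ^ p := by simp

lemma tendsto_sq_mul_div_rpow {p : ℝ} (hp : 2 < p) {s : ℝ} (hs : 0 ≤ s) :
    Tendsto (fun m : ℕ => ((m ^ 2 : ℕ) : ℝ) * (s / m) ^ p) atTop (nhds 0) := by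
  have h := ((tendsto_rpow_neg_atTop (sub_pos.2 hp)).comp
    (tendsto_natCast_atTop_atTop (R := ℝ))).const_mul (s ^ p)
  rw [mul_zero] at h
  refine h.congr' ?_
  filter_upwards [eventually_gt_atTop 0] with m hm
  have hm' : (0 : ℝ) < m := Nat.cast_pos.2 hm
  rw [Function.comp_apply, neg_sub, Real.rpow_sub hm', Real.div_rpow hs hm'.le]
  push_cast
  rw [Real.rpow_two]
  ring

/-- **No symmetric coercive continuous negative definite function on ℓ_p, p > 2.**
Fix `2 < p < ∞`. There is no continuous negative definite `g : ℓ_p → ℝ` with `g 0 = 0`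
which is symmetric (`g (T_{θ,σ} x) = g x` for all signs `θ`, permutations `σ`, and `x`)
and satisfies `g x ≥ φ₁(‖x‖)` for some nondecreasing `φ₁ : [0,∞) → [0,∞)` with
`φ₁(t) → ∞`. -/
theorem no_symmetric_coercive_negative_definite_on_lp
    (p : ℝ) (hp : 2 < p) [Fact (1 ≤ ENNReal.ofReal p)]
    (hp' : ENNReal.ofReal p ≠ ∞) :
    ¬ ∃ (g : lp (fun _ : ℕ => ℝ) (ENNReal.ofReal p) → ℝ) (φ₁ : ℝ≥0 → ℝ≥0),
        Continuous g ∧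
        (∀ (n : ℕ) (x : Fin n → lp (fun _ : ℕ => ℝ) (ENNReal.ofReal p)) (c : Fin n → ℝ),
          (∑ i, c i) = 0 → ∑ i, ∑ j, c i * c j * g (x i - x j) ≤ 0) ∧
        g 0 = 0 ∧
        (∀ (θ : ℕ → ℝ) (hθ : ∀ n, θ n = 1 ∨ θ n = -1) (σ : Equiv.Perm ℕ) (x),
          g (signPermMap (ENNReal.ofReal p) hp' θ hθ σ x) = g x) ∧
        Monotone φ₁ ∧ Tendsto φ₁ atTop atTop ∧
        (∀ x, (φ₁ ‖x‖₊ : ℝ) ≤ g x) := by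
  rintro ⟨g, φ₁, hcont, hneg, h0, -, -, hφ, hle⟩
  have hp0 : 0 < p := by linarith
  have hg := isNegDefFun_of_fin hneg
  obtain ⟨s, hs⟩ := (hφ.eventually_ge_atTop 5).exists
  obtain ⟨r, hr, hball⟩ := Metric.continuous_iff.1 hcont 0 1 one_pos
  have hev := (tendsto_sq_mul_div_rpow hp s.2).eventually_lt_const (Real.rpow_pos_of_pos hr p)
  obtain ⟨m, hm, hm0⟩ := (hev.and (eventually_gt_atTop 0)).exists
  have hm' : (0 : ℝ) < m := Nat.cast_pos.2 hm0
  have hδ : (0 : ℝ) ≤ s / m := div_nonneg s.2 hm'.le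
  let v : ℕ → lp (fun _ : ℕ => ℝ) (ENNReal.ofReal p) :=
    fun i => lp.single (E := fun _ : ℕ => ℝ) (ENNReal.ofReal p) i ((s : ℝ) / m)
  have hF : iteratedAverage v g (m ^ 2) 0 ≤ 1 := by
    refine iteratedAverage_le _ _ fun ε hε => ?_
    rw [zero_add]
    have hlt := (norm_sum_zsmul_single_rpow_le hp0 _ hδ (m ^ 2) ε hε).trans_lt hm
    have hnorm := (Real.rpow_lt_rpow_iff (norm_nonneg _) hr.le hp0).1 hlt
    have := hball _ (by rwa [dist_zero_right])
    rw [h0, Real.dist_eq, sub_zero] at this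
    exact (le_abs_self _).trans this.le
  have hnn : ∀ k, ‖m • v k‖₊ = s := by
    intro k
    have : m • v k = lp.single (E := fun _ : ℕ => ℝ) (ENNReal.ofReal p) k (s : ℝ) := by
      refine (map_nsmul (lp.singleAddMonoidHom (E := fun _ : ℕ => ℝ) (ENNReal.ofReal p) k) _ _).symm.trans ?_
      rw [nsmul_eq_mul, mul_div_cancel₀ _ hm'.ne']
      rfl
    rw [this]
    ext
    rw [coe_nnnorm, lp.norm_single (ENNReal.ofReal_pos.2 hp0)]
    simp
  have hs' : (5 : ℝ) ≤ φ₁ s := by exact_mod_cast hs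
  have hsum := hg.sum_nsmul_le v m (m ^ 2)
  have hlow : ∑ _k ∈ Finset.range (m ^ 2), (10 : ℝ) ≤
      ∑ k ∈ Finset.range (m ^ 2), (g (m • v k) + g (-(m • v k)) - 2 * g 0) := by
    refine Finset.sum_le_sum fun k _ => ?_
    have h1 := hle (m • v k)
    have h2 := hle (-(m • v k))
    rw [nnnorm_neg, hnn] at h2
    rw [hnn] at h1
    rw [h0]
    linarith
  rw [Finset.sum_const, Finset.card_range, nsmul_eq_mul] at hlow
  rw [h0] at hsum hlow
  rw [sub_zero] at hsum
  push_cast at hsum hlow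
  have hm2 : (0 : ℝ) < (m : ℝ) ^ 2 := by positivity
  nlinarith only [hsum, hlow, hm2, mul_le_mul_of_nonneg_left hF hm2.le]
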